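/- arXiv:2210.07112 — 2 statements merged into one kernel-verified Lean document; each statement's English description precedes it below -/
import Mathlib

section
/- The two definitions of the q,t-Catalan measure agree: suppose g : B_n → A_n is a bijection satisfying g(b)_j = ∑_{i=0}^{j−1} sc(b_j − b_i) for all b ∈ B_n and j = 1, …, n−1 (with the convention b_0 = 0), and define bounce : A_n → ℝ by bounce(a) = ∑_{j=1}^{n−1} (g^{-1}(a))_j. Then the pushforward of λ_n under the map a ↦ (dinv(a), area(a)) equals the pushforward of λ_n under the map a ↦ (area(a), bounce(a)). -/
open MeasureTheory Finset Filter

noncomputable section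

/-- `sc x = max (1 - |x|) 0`. -/
def sc (x : ℝ) : ℝ := max (1 - |x|) 0

/-- Extend `a : Fin k → ℝ` (thought of as coordinates `a_1, …, a_k`) to an ℕ-indexed
vector with the convention `a_0 = 0` (and value `0` beyond index `k`). -/
def cext {k : ℕ} (a : Fin k → ℝ) (i : ℕ) : ℝ :=
  if h : 1 ≤ i ∧ i ≤ k then a ⟨i - 1, by omega⟩ else 0

/-- The area polytope `A_n ⊆ ℝ^{n-1}`. -/
def areaPoly (n : ℕ) : Set (Fin (n - 1) → ℝ) :=
  {a | ∀ i < n - 1, 0 ≤ cext a (i + 1) ∧ cext a (i + 1) ≤ cext a i + 1}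

/-- The bounce polytope `B_n ⊆ ℝ^{n-1}`. -/
def bouncePoly (n : ℕ) : Set (Fin (n - 1) → ℝ) :=
  {b | ∀ i < n - 1, cext b i ≤ cext b (i + 1) ∧ cext b (i + 1) ≤ cext b i + 1}

/-- `area(a) = ∑_{i=0}^{n-1} a_i`. -/
def area (n : ℕ) (a : Fin (n - 1) → ℝ) : ℝ := ∑ i ∈ Finset.range n, cext a i

/-- `dinv(a) = ∑_{0 ≤ i < j ≤ n-1} sc(a_i - a_j)`. -/
def dinv (n : ℕ) (a : Fin (n - 1) → ℝ) : ℝ :=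
  ∑ j ∈ Finset.range n, ∑ i ∈ Finset.range j, sc (cext a i - cext a j)

/-- The `q,t`-Catalan measure `μ_n`: pushforward of Lebesgue measure restricted to `A_n`
under `a ↦ (dinv a, area a)`. -/
def qtMeasure (n : ℕ) : Measure (ℝ × ℝ) :=
  Measure.map (fun a => (dinv n a, area n a)) (volume.restrict (areaPoly n))

/-- The map `f` with `f(b)_j = ∑_{i=0}^{j-1} sc(b_j - b_i)` (convention `b_0 = 0`). -/
def fmap (n : ℕ) (b : Fin (n - 1) → ℝ) : Fin (n - 1) → ℝ :=
  fun j => ∑ i ∈ Finset.range (j.1 + 1), sc (cext b (j.1 + 1) - cext b i)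

section aux

lemma cext_zero {k : ℕ} (a : Fin k → ℝ) : cext a 0 = 0 := by simp [cext]

lemma cext_succ {k : ℕ} (a : Fin k → ℝ) (i : ℕ) (h : i < k) : cext a (i + 1) = a ⟨i, h⟩ := by
  simp [cext, Nat.succ_le_of_lt h]

/-- insert `x` at position `k`. -/
def ins {m : ℕ} (k : Fin (m + 1)) (x : ℝ) (a : Fin m → ℝ) : Fin (m + 1) → ℝ :=
  Fin.insertNth (α := fun _ => ℝ) k x a

lemma ins_same {m : ℕ} (k : Fin (m + 1)) (x : ℝ) (a : Fin m → ℝ) : ins k x a k = x := by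
  simp [ins]

lemma ins_above {m : ℕ} (k : Fin (m + 1)) (x : ℝ) (a : Fin m → ℝ) (j : Fin m) :
    ins k x a (k.succAbove j) = a j := by
  simp [ins]

lemma cext_ins_le {m : ℕ} (k : Fin (m + 1)) (x : ℝ) (a : Fin m → ℝ) (i : ℕ) (h : i ≤ k.1) :
    cext (ins k x a) i = cext a i := by
  rcases i with _ | i
  · simp [cext_zero]
  · have hk := k.2
    rw [cext_succ _ i (by omega), cext_succ _ i (by omega)]
    have := ins_above k x a ⟨i, by omega⟩
    rw [Fin.succAbove_of_castSucc_lt _ _ (by rw [Fin.lt_def]; simpa using h)] at this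
    exact this

lemma cext_ins_eq {m : ℕ} (k : Fin (m + 1)) (x : ℝ) (a : Fin m → ℝ) :
    cext (ins k x a) (k.1 + 1) = x := by
  rw [cext_succ _ k.1 k.2]; exact ins_same k x a

lemma cext_ins_gt {m : ℕ} (k : Fin (m + 1)) (x : ℝ) (a : Fin m → ℝ) (i : ℕ) (h : k.1 < i)
    (hi : i ≤ m) :
    cext (ins k x a) (i + 1) = cext a i := by
  rcases i with _ | i
  · omega
  · have hk := k.2
    rw [cext_succ _ (i+1) (by omega), cext_succ _ i (by omega)]
    have := ins_above k x a ⟨i, by omega⟩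
    rw [Fin.succAbove_of_le_castSucc _ _ (by rw [Fin.le_def]; simp; omega)] at this
    exact this

/-- multiset of values -/
def ms {m : ℕ} (a : Fin m → ℝ) : Multiset ℝ := (Finset.univ : Finset (Fin m)).val.map a

lemma mem_ms {m : ℕ} (a : Fin m → ℝ) (y : ℝ) : y ∈ ms a ↔ ∃ i, a i = y := by
  simp [ms]

lemma ms_ins {m : ℕ} (k : Fin (m + 1)) (x : ℝ) (a : Fin m → ℝ) :
    ms (ins k x a) = x ::ₘ ms a := by
  unfold ms
  rw [Fin.univ_succAbove m k]
  simp only [Finset.cons_val, Multiset.map_cons, Finset.map_val, Multiset.map_map, ins_same]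
  congr 1
  apply Multiset.map_congr rfl
  intro j _
  exact ins_above k x a j

lemma sum_cons0 {M : Type*} [AddCommMonoid M] {m : ℕ} (a : Fin m → ℝ) (φ : ℝ → M) :
    ((0 ::ₘ ms a).map φ).sum = ∑ i ∈ Finset.range (m + 1), φ (cext a i) := by
  rw [Finset.sum_range_succ', cext_zero, Multiset.map_cons, Multiset.sum_cons, add_comm,
    Finset.sum_range]
  congr 1
  unfold ms
  rw [Multiset.map_map]
  change ∑ i, φ (a i) = _
  apply Finset.sum_congr rfl
  intro i _
  rw [cext_succ _ i.1 i.2]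

lemma ins_mem_areaPoly {m : ℕ} (k : Fin (m + 1)) (x : ℝ) (a : Fin m → ℝ)
    (hx : ∀ j, a j < x) :
    ins k x a ∈ areaPoly (m + 1 + 1) ↔ a ∈ areaPoly (m + 1) ∧ 0 ≤ x ∧ x ≤ cext a k.1 + 1 := by
  have hk := k.2
  have h1 := cext_ins_eq k x a
  have hlt : ∀ i, i < m → cext a (i + 1) < x := by
    intro i hi; rw [cext_succ _ i hi]; exact hx _
  constructor
  · intro h
    have h : ∀ i < m + 1, 0 ≤ cext (ins k x a) (i + 1) ∧
      cext (ins k x a) (i + 1) ≤ cext (ins k x a) i + 1 := h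
    have hkk := h k.1 hk
    rw [h1, cext_ins_le k x a k.1 le_rfl] at hkk
    refine ⟨?_, hkk.1, hkk.2⟩
    intro i hi
    have hi : i < m := hi
    rcases lt_trichotomy i k.1 with hik | hik | hik
    · have := h i (by omega)
      rwa [cext_ins_le k x a i (by omega), cext_ins_le k x a (i+1) (by omega)] at this
    · have := h (i + 1) (by omega)
      rw [cext_ins_gt k x a (i+1) (by omega) (by omega)] at this
      have h3 := hlt i hi
      subst hik
      exact ⟨this.1, by linarith⟩
    · have := h (i + 1) (by omega)
      rwa [cext_ins_gt k x a (i+1) (by omega) (by omega),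
        cext_ins_gt k x a i (by omega) (by omega)] at this
  · rintro ⟨h, h0, hx1⟩
    have h : ∀ i < m, 0 ≤ cext a (i + 1) ∧ cext a (i + 1) ≤ cext a i + 1 := h
    intro i hi
    have hi : i < m + 1 := hi
    rcases lt_trichotomy i k.1 with hik | hik | hik
    · have := h i (by omega)
      rwa [cext_ins_le k x a i (by omega), cext_ins_le k x a (i+1) (by omega)]
    · subst hik
      rw [h1, cext_ins_le k x a k.1 le_rfl]
      exact ⟨h0, hx1⟩
    · obtain ⟨i, rfl⟩ : ∃ i', i = i' + 1 := ⟨i - 1, by omega⟩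
      rw [cext_ins_gt k x a (i+1) (by omega) (by omega)]
      have := h i (by omega)
      rcases Nat.lt_or_ge k.1 i with hik' | hik'
      · rw [cext_ins_gt k x a i (by omega) (by omega)]; exact this
      · have : i = k.1 := by omega
        subst this
        rw [h1]
        have := hlt k.1 (by omega)
        exact ⟨by linarith, by linarith⟩

lemma ins_mem_bouncePoly {m : ℕ} (x : ℝ) (a : Fin m → ℝ) :
    ins (Fin.last m) x a ∈ bouncePoly (m + 1 + 1) ↔
      a ∈ bouncePoly (m + 1) ∧ cext a m ≤ x ∧ x ≤ cext a m + 1 := by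
  have h1 := cext_ins_eq (Fin.last m) x a
  have h2 := cext_ins_le (Fin.last m) x a
  simp only [Fin.val_last] at h1 h2
  constructor
  · intro h
    have h : ∀ i < m + 1, cext (ins (Fin.last m) x a) i ≤ cext (ins (Fin.last m) x a) (i + 1) ∧
      cext (ins (Fin.last m) x a) (i + 1) ≤ cext (ins (Fin.last m) x a) i + 1 := h
    refine ⟨?_, ?_⟩
    · intro i hi
      have hi : i < m := hi
      have := h i (by omega)
      rwa [h2 i (by omega), h2 (i+1) (by omega)] at this
    · have := h m (by omega)
      rwa [h1, h2 m le_rfl] at this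
  · rintro ⟨h, h0⟩ i hi
    have h : ∀ i < m, cext a i ≤ cext a (i + 1) ∧ cext a (i + 1) ≤ cext a i + 1 := h
    have hi : i < m + 1 := hi
    rcases Nat.lt_or_ge i m with hik | hik
    · rw [h2 i (by omega), h2 (i+1) (by omega)]; exact h i hik
    · have : i = m := by omega
      subst this
      rw [h1, h2 i le_rfl]; exact h0

lemma bounce_mono {m : ℕ} {b : Fin m → ℝ} (hb : b ∈ bouncePoly (m + 1)) (i j : ℕ) (hij : i ≤ j)
    (hj : j ≤ m) : cext b i ≤ cext b j := by
  have hb : ∀ i < m, cext b i ≤ cext b (i + 1) ∧ cext b (i + 1) ≤ cext b i + 1 := hb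
  induction j, hij using Nat.le_induction with
  | base => exact le_rfl
  | succ j hij ih => exact (ih (by omega)).trans (hb j (by omega)).1

/-- number of admissible predecessors -/
def cnt (s : Multiset ℝ) (x : ℝ) : ENNReal :=
  ((0 ::ₘ s).map (fun y => if x ≤ y + 1 then (1 : ENNReal) else 0)).sum

lemma cnt_ms {m : ℕ} (a : Fin m → ℝ) (x : ℝ) :
    cnt (ms a) x = ∑ i ∈ Finset.range (m + 1), if x ≤ cext a i + 1 then (1 : ENNReal) else 0 :=
  sum_cons0 a _

def wt (m : ℕ) (b : Fin m → ℝ) : ENNReal :=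
  ∏ j ∈ Finset.range m, ∑ i ∈ Finset.range (j + 1),
    if cext b (j + 1) ≤ cext b i + 1 then (1 : ENNReal) else 0

lemma wt_ins {m : ℕ} (x : ℝ) (a : Fin m → ℝ) :
    wt (m + 1) (ins (Fin.last m) x a) = wt m a * cnt (ms a) x := by
  have h1 := cext_ins_eq (Fin.last m) x a
  have h2 := cext_ins_le (Fin.last m) x a
  simp only [Fin.val_last] at h1 h2
  unfold wt
  rw [Finset.prod_range_succ, cnt_ms, h1]
  congr 1
  · apply Finset.prod_congr rfl
    intro j hj
    apply Finset.sum_congr rfl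
    intro i hi
    simp only [Finset.mem_range] at hi hj
    rw [h2 _ (by omega), h2 _ (by omega)]
  · apply Finset.sum_congr rfl
    intro i hi
    simp only [Finset.mem_range] at hi
    rw [h2 _ (by omega)]

/-- coordinates as continuous linear maps -/
def cP (m : ℕ) (i : ℕ) : (Fin m → ℝ) →L[ℝ] ℝ :=
  if h : 1 ≤ i ∧ i ≤ m then ContinuousLinearMap.proj (R := ℝ) (φ := fun _ : Fin m => ℝ) ⟨i - 1, by omega⟩ else 0

lemma cP_apply (m i : ℕ) (b : Fin m → ℝ) : cP m i b = cext b i := by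
  unfold cP cext
  split_ifs <;> simp

lemma continuous_cext (m i : ℕ) : Continuous (fun b : Fin m → ℝ => cext b i) := by
  simp_rw [← cP_apply]; exact (cP m i).continuous

lemma measurable_cext (m i : ℕ) : Measurable (fun b : Fin m → ℝ => cext b i) :=
  (continuous_cext m i).measurable

lemma hyper (m i j : ℕ) (hij : i < j) (hj : j ≤ m) (c : ℝ) :
    ∀ᵐ b : Fin m → ℝ, cext b i - cext b j ≠ c := by
  let L : (Fin m → ℝ) →ₗ[ℝ] ℝ := (cP m i - cP m j : (Fin m → ℝ) →L[ℝ] ℝ)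
  have hLa : ∀ b, L b = cext b i - cext b j := by
    intro b; simp [L, cP_apply]
  have hL : Function.Surjective L := by
    intro y
    refine ⟨fun t => if t.1 + 1 = j then -y else 0, ?_⟩
    rw [hLa]
    obtain ⟨j, rfl⟩ : ∃ j', j = j' + 1 := ⟨j - 1, by omega⟩
    rw [cext_succ _ j (by omega)]
    rcases i with _ | i
    · simp [cext_zero]
    · rw [cext_succ _ i (by omega)]
      simp; omega
  obtain ⟨d, -, hd⟩ := LinearMap.exists_map_addHaar_eq_smul_addHaar (L := L) volume volume hL
  have hm : Measurable L := by
    have : (L : (Fin m → ℝ) → ℝ) = fun b => cext b i - cext b j := funext hLa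
    rw [this]; exact (measurable_cext m i).sub (measurable_cext m j)
  have : (Measure.map L volume) {c} = 0 := by rw [hd]; simp
  rw [Measure.map_apply hm (measurableSet_singleton c)] at this
  rw [ae_iff]
  convert this using 2
  ext b
  simp [hLa]

lemma generic (m : ℕ) : ∀ᵐ b : Fin m → ℝ, ∀ i j, i < j → j ≤ m →
    cext b i - cext b j ≠ 0 ∧ cext b i - cext b j ≠ 1 ∧ cext b i - cext b j ≠ -1 := by
  rw [ae_all_iff]; intro i
  rw [ae_all_iff]; intro j
  by_cases h : i < j ∧ j ≤ m
  · filter_upwards [hyper m i j h.1 h.2 0, hyper m i j h.1 h.2 1, hyper m i j h.1 h.2 (-1)]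
      with b h1 h2 h3 _ _
    exact ⟨h1, h2, h3⟩
  · filter_upwards with b h1 h2
    exact absurd ⟨h1, h2⟩ h

lemma ae_distinct (m : ℕ) : ∀ᵐ b : Fin m → ℝ, ∀ i j, i ≠ j → b i ≠ b j := by
  filter_upwards [generic m] with b hb i j hij h
  rcases lt_or_gt_of_ne hij with h' | h'
  · have := (hb (i.1+1) (j.1+1) (by have : i.1 < j.1 := h'; omega) (by omega)).1
    rw [cext_succ _ _ i.2, cext_succ _ _ j.2] at this
    exact this (sub_eq_zero.2 h)
  · have := (hb (j.1+1) (i.1+1) (by have : j.1 < i.1 := h'; omega) (by omega)).1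
    rw [cext_succ _ _ i.2, cext_succ _ _ j.2] at this
    exact this (sub_eq_zero.2 h.symm)

lemma meas_area (m : ℕ) : MeasurableSet (areaPoly (m + 1)) := by
  have : areaPoly (m + 1) = ⋂ i, ⋂ (_ : i < m), {a : Fin m → ℝ |
    0 ≤ cext a (i + 1) ∧ cext a (i + 1) ≤ cext a i + 1} := by
    ext a; simp [areaPoly]
  rw [this]
  refine MeasurableSet.iInter fun i => MeasurableSet.iInter fun _ => ?_
  exact (measurableSet_le measurable_const (measurable_cext m (i+1))).inter
    (measurableSet_le (measurable_cext m (i+1)) ((measurable_cext m i).add_const 1))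

lemma meas_bounce (m : ℕ) : MeasurableSet (bouncePoly (m + 1)) := by
  have : bouncePoly (m + 1) = ⋂ i, ⋂ (_ : i < m), {a : Fin m → ℝ |
    cext a i ≤ cext a (i + 1) ∧ cext a (i + 1) ≤ cext a i + 1} := by
    ext a; simp [bouncePoly]
  rw [this]
  refine MeasurableSet.iInter fun i => MeasurableSet.iInter fun _ => ?_
  exact (measurableSet_le (measurable_cext m i) (measurable_cext m (i+1))).inter
    (measurableSet_le (measurable_cext m (i+1)) ((measurable_cext m i).add_const 1))

lemma meas_wt (m : ℕ) : Measurable (wt m) := by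
  unfold wt
  refine Finset.measurable_prod _ fun j _ => Finset.measurable_sum _ fun i _ => ?_
  exact Measurable.ite (measurableSet_le (measurable_cext m (j+1))
    ((measurable_cext m i).add_const 1)) measurable_const measurable_const

lemma meas_ins {m : ℕ} (k : Fin (m + 1)) :
    Measurable (fun p : ℝ × (Fin m → ℝ) => ins k p.1 p.2) :=
  (MeasurableEquiv.piFinSuccAbove (fun _ => ℝ) k).symm.measurable

lemma lintegral_ins {m : ℕ} (k : Fin (m + 1)) (F : (Fin (m + 1) → ℝ) → ENNReal) :
    ∫⁻ a, F a = ∫⁻ p : ℝ × (Fin m → ℝ), F (ins k p.1 p.2) := by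
  have h := (volume_preserving_piFinSuccAbove (fun _ : Fin (m + 1) => ℝ) k).symm
  exact (h.lintegral_comp_emb (MeasurableEquiv.measurableEmbedding _) F).symm


lemma strict_max_unique {m : ℕ} (a : Fin (m + 1) → ℝ) (ha : ∀ i j, i ≠ j → a i ≠ a j) :
    (∑ k : Fin (m + 1), if ∀ j, a (k.succAbove j) < a k then (1 : ENNReal) else 0) = 1 := by
  obtain ⟨k, -, hk⟩ := Finset.exists_max_image Finset.univ a Finset.univ_nonempty
  have hk' : ∀ i, i ≠ k → a i < a k := fun i hi =>
    lt_of_le_of_ne (hk i (Finset.mem_univ _)) (ha _ _ hi)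
  rw [Finset.sum_eq_single k]
  · rw [if_pos]
    intro j; exact hk' _ (Fin.succAbove_ne k j)
  · intro i _ hi
    rw [if_neg]
    intro h
    obtain ⟨j, hj⟩ := Fin.exists_succAbove_eq hi.symm
    have := h j
    rw [hj] at this
    exact absurd this (not_lt.2 (hk i (Finset.mem_univ _)))
  · simp

lemma comb (m : ℕ) : ∀ Ψ : Multiset ℝ → ENNReal, Measurable (fun a : Fin m → ℝ => Ψ (ms a)) →
    ∫⁻ a in areaPoly (m + 1), Ψ (ms a) = ∫⁻ b in bouncePoly (m + 1), wt m b * Ψ (ms b) := by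
  classical
  induction m with
  | zero =>
    intro Ψ _
    have h1 : areaPoly (0 + 1) = Set.univ := by ext; simp [areaPoly]
    have h2 : bouncePoly (0 + 1) = Set.univ := by ext; simp [bouncePoly]
    rw [h1, h2]; simp [wt]
  | succ m ih =>
    intro Ψ hΨ
    let Ψ' : Multiset ℝ → ENNReal := fun s =>
      ∫⁻ x : ℝ, if 0 ≤ x ∧ ∀ y ∈ s, y < x then cnt s x * Ψ (x ::ₘ s) else 0
    have hpair : Measurable (fun p : ℝ × (Fin m → ℝ) => Ψ (p.1 ::ₘ ms p.2)) := by
      have := hΨ.comp (meas_ins (m := m) (Fin.last m))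
      simpa only [Function.comp_def, ms_ins] using this
    have hset : MeasurableSet {p : ℝ × (Fin m → ℝ) | ∀ j, p.2 j < p.1} := by
      rw [Set.ofPred_forall]
      exact MeasurableSet.iInter fun j =>
        measurableSet_lt ((measurable_pi_apply j).comp measurable_snd) measurable_fst
    have hset0 : MeasurableSet {p : ℝ × (Fin m → ℝ) | 0 ≤ p.1} :=
      measurableSet_le measurable_const measurable_fst
    have hcnt : Measurable (fun p : ℝ × (Fin m → ℝ) => cnt (ms p.2) p.1) := by
      simp_rw [cnt_ms]
      refine Finset.measurable_sum _ fun i _ => ?_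
      exact Measurable.ite (measurableSet_le measurable_fst
        (((measurable_cext m i).comp measurable_snd).add_const 1)) measurable_const measurable_const
    have hmem : ∀ (a : Fin m → ℝ) (x : ℝ), (∀ y ∈ ms a, y < x) ↔ ∀ j, a j < x := by
      intro a x; simp [mem_ms]
    have hK : Measurable (fun p : ℝ × (Fin m → ℝ) =>
        if 0 ≤ p.1 ∧ ∀ y ∈ ms p.2, y < p.1 then cnt (ms p.2) p.1 * Ψ (p.1 ::ₘ ms p.2) else 0) := by
      simp_rw [hmem]
      exact Measurable.ite (hset0.inter hset) (hcnt.mul hpair) measurable_const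
    have hΨ' : Measurable (fun a : Fin m → ℝ => Ψ' (ms a)) :=
      Measurable.lintegral_prod_left' (μ := (volume : Measure ℝ)) hK
    have IH := ih Ψ' hΨ'
    have hA := meas_area m
    have hA1 := meas_area (m + 1)
    have hB := meas_bounce m
    have hB1 := meas_bounce (m + 1)
    -- area side
    have key1 : ∫⁻ a in areaPoly (m + 1 + 1), Ψ (ms a) = ∫⁻ a in areaPoly (m + 1), Ψ' (ms a) := by
      rw [← lintegral_indicator hA1, ← lintegral_indicator hA]
      have e1 : ∫⁻ a : Fin (m + 1) → ℝ, (areaPoly (m + 1 + 1)).indicator (fun a => Ψ (ms a)) a =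
          ∫⁻ a : Fin (m + 1) → ℝ, ∑ k : Fin (m + 1),
            (if ∀ j, a (k.succAbove j) < a k then (1 : ENNReal) else 0) *
            (areaPoly (m + 1 + 1)).indicator (fun a => Ψ (ms a)) a := by
        apply lintegral_congr_ae
        filter_upwards [ae_distinct (m + 1)] with a ha
        rw [← Finset.sum_mul, strict_max_unique a ha, one_mul]
      have hind : Measurable ((areaPoly (m + 1 + 1)).indicator
          (fun a : Fin (m + 1) → ℝ => Ψ (ms a))) := hΨ.indicator hA1
      have hs : ∀ k : Fin (m + 1), MeasurableSet {a : Fin (m + 1) → ℝ |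
          ∀ j, a (k.succAbove j) < a k} := by
        intro k
        rw [Set.ofPred_forall]
        exact MeasurableSet.iInter fun j =>
          measurableSet_lt (measurable_pi_apply _) (measurable_pi_apply _)
      have hF : ∀ k : Fin (m + 1), Measurable (fun a : Fin (m + 1) → ℝ =>
            (if ∀ j, a (k.succAbove j) < a k then (1 : ENNReal) else 0) *
            (areaPoly (m + 1 + 1)).indicator (fun a => Ψ (ms a)) a) := fun k =>
        (Measurable.ite (hs k) measurable_const measurable_const).mul hind
      have e1' := e1.trans (lintegral_finsetSum (Finset.univ : Finset (Fin (m+1))) fun k _ => hF k)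
      refine e1'.trans ?_
      have e2 : ∀ k : Fin (m + 1), _ := fun k => lintegral_ins k (fun a : Fin (m + 1) → ℝ =>
            (if ∀ j, a (k.succAbove j) < a k then (1 : ENNReal) else 0) *
            (areaPoly (m + 1 + 1)).indicator (fun a => Ψ (ms a)) a)
      rw [Finset.sum_congr rfl fun k _ => e2 k]
      rw [← lintegral_finsetSum]
      swap
      · intro k _; exact (hF k).comp (meas_ins k)
      have e3 : ∀ p : ℝ × (Fin m → ℝ), (∑ k : Fin (m + 1),
          (if ∀ j, ins k p.1 p.2 (k.succAbove j) < ins k p.1 p.2 k then (1 : ENNReal) else 0) *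
            (areaPoly (m + 1 + 1)).indicator (fun a => Ψ (ms a)) (ins k p.1 p.2)) =
          (areaPoly (m + 1)).indicator (fun _ => if 0 ≤ p.1 ∧ ∀ y ∈ ms p.2, y < p.1 then
            cnt (ms p.2) p.1 * Ψ (p.1 ::ₘ ms p.2) else 0) p.2 := by
        rintro ⟨x, a⟩
        simp only [ins_same, ins_above, hmem]
        by_cases hx : ∀ j, a j < x
        · simp only [hx, implies_true, if_true, one_mul, and_true]
          have : ∀ k : Fin (m + 1), (areaPoly (m + 1 + 1)).indicator (fun a => Ψ (ms a))
              (ins k x a) = (if x ≤ cext a k.1 + 1 then (1 : ENNReal) else 0) *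
                (if a ∈ areaPoly (m + 1) ∧ 0 ≤ x then Ψ (x ::ₘ ms a) else 0) := by
            intro k
            rw [Set.indicator_apply]
            have := ins_mem_areaPoly k x a hx
            rw [ms_ins]
            by_cases h1 : a ∈ areaPoly (m + 1) <;> by_cases h2 : 0 ≤ x <;>
              by_cases h3 : x ≤ cext a k.1 + 1 <;> simp [this, h1, h2, h3]
          rw [Finset.sum_congr rfl fun k _ => this k, ← Finset.sum_mul, cnt_ms,
            Finset.sum_range, Set.indicator_apply]
          by_cases h1 : a ∈ areaPoly (m + 1) <;> by_cases h2 : 0 ≤ x <;> simp [h1, h2]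
        · simp [hx]
      rw [lintegral_congr e3, Measure.volume_eq_prod, lintegral_prod_symm']
      · apply lintegral_congr
        intro a
        by_cases h : a ∈ areaPoly (m + 1)
        · simp only [Set.indicator_of_mem h, Ψ']
        · simp [Set.indicator_of_notMem h]
      · have : Measurable (((Prod.snd : ℝ × (Fin m → ℝ) → _) ⁻¹' (areaPoly (m + 1))).indicator
          (fun p : ℝ × (Fin m → ℝ) =>
        if 0 ≤ p.1 ∧ ∀ y ∈ ms p.2, y < p.1 then cnt (ms p.2) p.1 * Ψ (p.1 ::ₘ ms p.2) else 0)) :=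
          hK.indicator (measurable_snd hA)
        exact this
    -- bounce side
    have key2 : ∫⁻ b in bouncePoly (m + 1 + 1), wt (m + 1) b * Ψ (ms b) =
        ∫⁻ b in bouncePoly (m + 1), wt m b * Ψ' (ms b) := by
      rw [← lintegral_indicator hB1, ← lintegral_indicator hB]
      have hm : Measurable ((bouncePoly (m + 1 + 1)).indicator
          (fun b : Fin (m + 1) → ℝ => wt (m + 1) b * Ψ (ms b))) :=
        ((meas_wt (m + 1)).mul hΨ).indicator hB1
      refine (lintegral_ins (Fin.last m) _).trans ?_
      rw [Measure.volume_eq_prod]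
      refine (lintegral_prod_symm' _ (hm.comp (meas_ins (Fin.last m)))).trans ?_
      simp only [Function.comp_def]
      apply lintegral_congr
      intro b
      by_cases hb : b ∈ bouncePoly (m + 1)
      swap
      · rw [Set.indicator_of_notMem hb]
        rw [lintegral_eq_zero_of_ae_eq_zero]
        filter_upwards with x
        exact Set.indicator_of_notMem (fun h => hb ((ins_mem_bouncePoly x b).1 h).1) _
      rw [Set.indicator_of_mem hb]
      simp only [Ψ']
      have hKb : Measurable (fun x : ℝ => if 0 ≤ x ∧ ∀ y ∈ ms b, y < x then
          cnt (ms b) x * Ψ (x ::ₘ ms b) else 0) :=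
        hK.comp (measurable_id.prodMk measurable_const)
      rw [← lintegral_const_mul _ hKb]
      apply lintegral_congr_ae
      have hne : ∀ᵐ x : ℝ, x ≠ cext b m := by
        rw [ae_iff]; simp
      filter_upwards [hne] with x hx
      simp only [Set.indicator_apply, ins_mem_bouncePoly, hb, true_and, wt_ins, ms_ins, hmem]
      have hle : ∀ j : Fin m, b j ≤ cext b m := by
        intro j
        rw [← cext_succ b j.1 j.2]
        exact bounce_mono hb _ _ (by omega) le_rfl
      rcases lt_or_gt_of_ne hx with hx | hx
      · rw [if_neg (fun h => absurd h.1 (not_le.2 hx)), if_neg, mul_zero]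
        rintro ⟨h0, h1⟩
        rcases m with _ | m
        · rw [cext_zero] at hx; linarith
        · rw [cext_succ b m (by omega)] at hx
          exact absurd (h1 _) (not_lt.2 hx.le)
      · have hc : 0 ≤ x ∧ ∀ j, b j < x := by
          refine ⟨?_, fun j => (hle j).trans_lt hx⟩
          have := bounce_mono hb 0 m (by omega) le_rfl
          rw [cext_zero] at this; linarith
        rw [if_pos hc]
        by_cases h1 : x ≤ cext b m + 1
        · rw [if_pos ⟨hx.le, h1⟩, mul_assoc]
        · rw [if_neg (fun h => h1 h.2)]
          have : cnt (ms b) x = 0 := by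
            rw [cnt_ms]
            apply Finset.sum_eq_zero
            intro i hi
            simp only [Finset.mem_range] at hi
            rw [if_neg]
            have := bounce_mono hb i m (by omega) le_rfl
            intro h; apply h1; linarith
          rw [this]; simp
    rw [key1, key2, IH]


lemma sc_neg (x : ℝ) : sc (-x) = sc x := by simp [sc]

lemma sc_lip (x y : ℝ) : |sc x - sc y| ≤ |x - y| := by
  unfold sc
  refine (abs_max_sub_max_le_abs _ _ _).trans ?_
  have := abs_abs_sub_abs_le y x
  rw [abs_sub_comm x y]
  have e : 1 - |x| - (1 - |y|) = |y| - |x| := by ring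
  rw [e]; exact this

lemma continuous_sc : Continuous sc := by
  unfold sc; fun_prop

lemma sc_hasDeriv (x : ℝ) (h0 : 0 < x) (h1 : x ≠ 1) :
    HasDerivAt sc (if x ≤ 1 then -1 else 0) x := by
  rcases lt_or_gt_of_ne h1 with h | h
  · rw [if_pos h.le]
    have : HasDerivAt (fun y : ℝ => 1 - y) (-1) x := by
      simpa using (hasDerivAt_id x).const_sub 1
    refine this.congr_of_eventuallyEq ?_
    filter_upwards [Ioo_mem_nhds h0 h] with y hy
    simp only [sc, abs_of_pos hy.1]
    exact max_eq_left (by linarith [hy.2])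
  · rw [if_neg (not_le.2 h)]
    refine (hasDerivAt_const x (0 : ℝ)).congr_of_eventuallyEq ?_
    filter_upwards [Ioi_mem_nhds h] with y hy
    have hy : 1 < y := hy
    simp only [sc, abs_of_pos (zero_lt_one.trans hy)]
    exact max_eq_right (by linarith)

lemma continuous_fmap (m : ℕ) : Continuous (fmap (m + 1)) := by
  refine continuous_pi fun j => ?_
  unfold fmap
  refine continuous_finsetSum _ fun i _ => ?_
  exact continuous_sc.comp ((continuous_cext m _).sub (continuous_cext m _))

lemma cext_lip {m : ℕ} (i : ℕ) (a b : Fin m → ℝ) : |cext a i - cext b i| ≤ dist a b := by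
  unfold cext
  split_ifs with h
  · exact dist_le_pi_dist a b _
  · simp

lemma fmap_lip (m : ℕ) : LipschitzWith (Real.toNNReal (2 * m)) (fmap (m + 1)) := by
  apply LipschitzWith.of_dist_le_mul
  intro a b
  rw [Real.coe_toNNReal _ (by positivity), dist_pi_le_iff (by positivity)]
  intro j
  have hj : j.1 < m := j.2
  rw [Real.dist_eq]
  unfold fmap
  rw [← Finset.sum_sub_distrib]
  refine (Finset.abs_sum_le_sum_abs _ _).trans ?_
  have : ∀ i ∈ Finset.range (j.1 + 1), |sc (cext a (j.1 + 1) - cext a i) -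
      sc (cext b (j.1 + 1) - cext b i)| ≤ 2 * dist a b := by
    intro i _
    refine (sc_lip _ _).trans ?_
    have h1 := cext_lip (j.1 + 1) a b
    have h2 := cext_lip i a b
    rw [abs_le] at *
    constructor <;> linarith [h1.1, h1.2, h2.1, h2.2]
  refine (Finset.sum_le_sum this).trans ?_
  rw [Finset.sum_const, Finset.card_range, nsmul_eq_mul]
  have h3 : ((j.1 + 1 : ℕ) : ℝ) ≤ m := by exact_mod_cast hj
  have h4 : (0 : ℝ) ≤ dist a b := dist_nonneg
  nlinarith

open scoped MeasureTheory in
lemma fmap_null (m : ℕ) (N : Set (Fin m → ℝ)) (hN : volume N = 0) :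
    volume (fmap (m + 1) '' N) = 0 := by
  have h := (fmap_lip m).hausdorffMeasure_image_le (d := (Fintype.card (Fin m) : ℝ))
    (by positivity) N
  have e := hausdorffMeasure_pi_real (ι := Fin m)
  have e1 : μH[(Fintype.card (Fin m) : ℝ)] N = 0 := by rw [e]; exact hN
  rw [e1, mul_zero] at h
  have h2 := le_antisymm h bot_le
  rw [← e]; exact h2

/-- derivative of `fmap` -/
def fder (m : ℕ) (b : Fin m → ℝ) : (Fin m → ℝ) →L[ℝ] (Fin m → ℝ) :=
  ContinuousLinearMap.pi fun j : Fin m => ∑ i ∈ Finset.range (j.1 + 1),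
    (if cext b (j.1 + 1) ≤ cext b i + 1 then (-1 : ℝ) else 0) • (cP m (j.1 + 1) - cP m i)

def genSet (m : ℕ) : Set (Fin m → ℝ) := {b | ∀ i j, i < j → j ≤ m →
    cext b i - cext b j ≠ 0 ∧ cext b i - cext b j ≠ 1 ∧ cext b i - cext b j ≠ -1}

lemma fmap_deriv (m : ℕ) (b : Fin m → ℝ) (hb : b ∈ bouncePoly (m + 1)) (hg : b ∈ genSet m) :
    HasFDerivAt (fmap (m + 1)) (fder m b) b := by
  unfold fder
  rw [hasFDerivAt_pi']
  intro j
  rw [ContinuousLinearMap.proj_pi]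
  unfold fmap
  refine HasFDerivAt.fun_sum fun i hi => ?_
  simp only [Finset.mem_range] at hi
  have hj : j.1 < m := j.2
  have hlin : HasFDerivAt (fun b : Fin m → ℝ => cext b (j.1 + 1) - cext b i)
      (cP m (j.1 + 1) - cP m i) b := by
    have := (cP m (j.1 + 1) - cP m i).hasFDerivAt (x := b)
    refine this.congr_of_eventuallyEq (Filter.Eventually.of_forall fun y => ?_)
    simp [cP_apply]
  have hle := bounce_mono hb i (j.1 + 1) (by omega) (by omega)
  have hgg := hg i (j.1 + 1) (by omega) (by omega)
  have h0 : 0 < cext b (j.1 + 1) - cext b i := by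
    rcases hle.lt_or_eq with h | h
    · linarith
    · exact absurd (sub_eq_zero.2 h) hgg.1
  have h1 : cext b (j.1 + 1) - cext b i ≠ 1 := fun h => hgg.2.2 (by linarith)
  have hd := sc_hasDeriv _ h0 h1
  have e : (cext b (j.1 + 1) - cext b i ≤ 1) = (cext b (j.1 + 1) ≤ cext b i + 1) := by
    rw [sub_le_iff_le_add, add_comm (1 : ℝ)]
  simp only [e] at hd
  exact hd.comp_hasFDerivAt b hlin

lemma cP_single (m : ℕ) (i : ℕ) (k : Fin m) :
    cP m i (Pi.single k 1) = if i = k.1 + 1 then 1 else 0 := by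
  rw [cP_apply]
  unfold cext
  split_ifs with h h2 h2
  · subst h2; simp
  · rw [Pi.single_apply, if_neg]
    intro h3; apply h2; rw [← h3]; simp; omega
  · have := k.2; omega
  · rfl

lemma fder_det (m : ℕ) (b : Fin m → ℝ) : ENNReal.ofReal |(fder m b).det| = wt m b := by
  have hM : ∀ j k : Fin m, (LinearMap.toMatrix' (fder m b : (Fin m → ℝ) →ₗ[ℝ] (Fin m → ℝ))) j k =
      ∑ i ∈ Finset.range (j.1 + 1), (if cext b (j.1 + 1) ≤ cext b i + 1 then (-1 : ℝ) else 0) *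
        ((if j.1 + 1 = k.1 + 1 then 1 else 0) - (if i = k.1 + 1 then 1 else 0)) := by
    intro j k
    rw [LinearMap.toMatrix'_apply]
    simp only [fder, ContinuousLinearMap.coe_coe, ContinuousLinearMap.pi_apply,
      ContinuousLinearMap.sum_apply, ContinuousLinearMap.smul_apply,
      ContinuousLinearMap.sub_apply, cP_single, smul_eq_mul]
  have hdet : (fder m b).det = ∏ j : Fin m, ∑ i ∈ Finset.range (j.1 + 1),
      (if cext b (j.1 + 1) ≤ cext b i + 1 then (-1 : ℝ) else 0) := by
    change LinearMap.det _ = _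
    rw [← LinearMap.det_toMatrix', Matrix.det_of_isLowerTriangular]
    · apply Finset.prod_congr rfl
      intro j _
      rw [hM]
      apply Finset.sum_congr rfl
      intro i hi
      simp only [Finset.mem_range] at hi
      rw [if_pos rfl, if_neg (by omega : ¬ i = j.1 + 1)]; ring
    · intro j k hjk
      have hjk : j.1 < k.1 := hjk
      rw [hM]
      apply Finset.sum_eq_zero
      intro i hi
      simp only [Finset.mem_range] at hi
      rw [if_neg (by omega : ¬ j.1 + 1 = k.1 + 1), if_neg (by omega : ¬ i = k.1 + 1)]; ring
  rw [hdet, Finset.abs_prod, ENNReal.ofReal_prod_of_nonneg (fun _ _ => abs_nonneg _)]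
  unfold wt
  rw [Finset.prod_range]
  apply Finset.prod_congr rfl
  intro j _
  have : ∑ i ∈ Finset.range (j.1 + 1),
      (if cext b (j.1 + 1) ≤ cext b i + 1 then (-1 : ℝ) else 0) =
      - ∑ i ∈ Finset.range (j.1 + 1),
      (if cext b (j.1 + 1) ≤ cext b i + 1 then (1 : ℝ) else 0) := by
    rw [← Finset.sum_neg_distrib]
    apply Finset.sum_congr rfl
    intro i _
    split_ifs <;> simp
  have hn : ∀ i ∈ Finset.range (j.1 + 1),
      (0:ℝ) ≤ (if cext b (j.1 + 1) ≤ cext b i + 1 then (1 : ℝ) else 0) := by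
    intro i _; split_ifs <;> simp
  rw [this, abs_neg, abs_of_nonneg (Finset.sum_nonneg hn), ENNReal.ofReal_sum_of_nonneg hn]
  apply Finset.sum_congr rfl
  intro i _
  split_ifs <;> simp

lemma cov (m : ℕ) (hbij : Set.BijOn (fmap (m + 1)) (bouncePoly (m + 1)) (areaPoly (m + 1))) :
    Measure.map (fmap (m + 1))
      (((volume : Measure (Fin m → ℝ)).restrict (bouncePoly (m + 1))).withDensity (wt m)) =
      (volume : Measure (Fin m → ℝ)).restrict (areaPoly (m + 1)) := by
  set B : Set (Fin m → ℝ) := bouncePoly (m + 1) with hB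
  have hGc : volume (genSet m)ᶜ = 0 := generic m
  set s : Set (Fin m → ℝ) := B ∩ genSet m with hs
  have hBs : volume (B \ s) = 0 := by
    refine measure_mono_null ?_ hGc
    rintro x ⟨h1, h2⟩ h3
    exact h2 ⟨h1, h3⟩
  have hsB : s =ᵐ[volume] B :=
    (ae_le_set.2 (by rw [Set.sdiff_eq_empty.2 Set.inter_subset_left]; simp)).antisymm
      (ae_le_set.2 hBs)
  have hsm : NullMeasurableSet s volume :=
    (meas_bounce m).nullMeasurableSet.congr hsB.symm
  have key := map_withDensity_abs_det_fderiv_eq_addHaar (μ := (volume : Measure (Fin m → ℝ)))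
    (s := s) (f := fmap (m + 1)) (f' := fder m) hsm
    (fun x hx => (fmap_deriv m x hx.1 hx.2).hasFDerivWithinAt)
    (hbij.injOn.mono Set.inter_subset_left)
  have hw : (fun x => ENNReal.ofReal |(fder m x).det|) = wt m := funext (fder_det m)
  rw [hw, Measure.restrict_congr_set hsB] at key
  rw [key]
  apply Measure.restrict_congr_set
  refine (ae_le_set.2 ?_).antisymm (ae_le_set.2 ?_)
  · rw [Set.sdiff_eq_empty.2]
    · simp
    · rintro _ ⟨x, hx, rfl⟩
      exact hbij.mapsTo hx.1
  · refine measure_mono_null ?_ (fmap_null m _ hBs)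
    rintro a ⟨ha, ha'⟩
    obtain ⟨x, hx, rfl⟩ := hbij.surjOn ha
    exact ⟨x, ⟨hx, fun h => ha' ⟨x, h, rfl⟩⟩, rfl⟩

/-- area as a function of the multiset -/
def Ar (s : Multiset ℝ) : ℝ := ((0 ::ₘ s).map id).sum

def Dv (s : Multiset ℝ) : ℝ :=
  (((0 ::ₘ s).map fun y => ((0 ::ₘ s).map fun z => sc (y - z)).sum).sum -
    ((0 ::ₘ s).map fun _ => (1 : ℝ)).sum) / 2

lemma area_eq (m : ℕ) (a : Fin m → ℝ) : area (m + 1) a = Ar (ms a) := by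
  unfold Ar
  rw [sum_cons0]; rfl

lemma dbl_sum (u : ℕ → ℝ) (n : ℕ) :
    ∑ i ∈ Finset.range n, ∑ j ∈ Finset.range n, sc (u i - u j) =
      2 * (∑ j ∈ Finset.range n, ∑ i ∈ Finset.range j, sc (u i - u j)) + n := by
  induction n with
  | zero => simp
  | succ n ih =>
    rw [Finset.sum_range_succ]
    simp_rw [Finset.sum_range_succ _ n]
    rw [Finset.sum_add_distrib, ih]
    have : ∑ x ∈ Finset.range n, sc (u n - u x) = ∑ x ∈ Finset.range n, sc (u x - u n) := by
      apply Finset.sum_congr rfl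
      intro i _
      rw [← sc_neg]; congr 1; ring
    have h1 : sc (u n - u n) = 1 := by simp [sc]
    rw [this, h1]; push_cast; ring

lemma dinv_eq (m : ℕ) (a : Fin m → ℝ) : dinv (m + 1) a = Dv (ms a) := by
  unfold Dv
  simp_rw [sum_cons0]
  rw [dbl_sum (fun i => cext a i)]
  simp [dinv]

lemma area_fmap (m : ℕ) (b : Fin m → ℝ) : area (m + 1) (fmap (m + 1) b) = dinv (m + 1) b := by
  unfold area dinv
  rw [Finset.sum_range_succ', cext_zero, Finset.sum_range_succ' _ m]
  simp only [Finset.range_zero, Finset.sum_empty, add_zero]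
  apply Finset.sum_congr rfl
  intro j hj
  rw [Finset.mem_range] at hj
  rw [cext_succ _ j hj]
  unfold fmap
  apply Finset.sum_congr rfl
  intro i _
  rw [← sc_neg]; congr 1; ring

lemma area_sum (m : ℕ) (b : Fin m → ℝ) : area (m + 1) b = ∑ j, b j := by
  unfold area
  rw [Finset.sum_range_succ', cext_zero, add_zero, Finset.sum_range]
  apply Finset.sum_congr rfl
  intro i _
  rw [cext_succ _ _ i.2]

lemma meas_pair (m : ℕ) :
    Measurable (fun a : Fin m → ℝ => (dinv (m + 1) a, area (m + 1) a)) := by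
  refine Measurable.prodMk ?_ ?_
  · unfold dinv
    refine Finset.measurable_sum _ fun j _ => Finset.measurable_sum _ fun i _ => ?_
    exact continuous_sc.measurable.comp ((measurable_cext m _).sub (measurable_cext m _))
  · unfold area
    exact Finset.measurable_sum _ fun j _ => measurable_cext m _

lemma left_side (m : ℕ) :
    Measure.map (fun a : Fin m → ℝ => (dinv (m + 1) a, area (m + 1) a))
      ((volume : Measure (Fin m → ℝ)).restrict (areaPoly (m + 1))) =
    Measure.map (fun a : Fin m → ℝ => (dinv (m + 1) a, area (m + 1) a))
      (((volume : Measure (Fin m → ℝ)).restrict (bouncePoly (m + 1))).withDensity (wt m)) := by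
  ext E hE
  have hp := meas_pair m
  rw [← lintegral_indicator_one hE, ← lintegral_indicator_one hE,
    lintegral_map (measurable_one.indicator hE) hp, lintegral_map (measurable_one.indicator hE) hp]
  refine Eq.trans ?_ (lintegral_withDensity_eq_lintegral_mul _ (meas_wt m)
    ((measurable_one.indicator hE).comp hp)).symm
  have := comb m (fun s => E.indicator 1 (Dv s, Ar s)) (by
    simp_rw [← dinv_eq, ← area_eq]
    exact (measurable_one.indicator hE).comp hp)
  simp_rw [← dinv_eq, ← area_eq] at this
  exact this

end aux

/-- The two definitions of the q,t-Catalan measure agree: if `g : B_n → A_n` is a bijection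
given by the formula `g(b)_j = ∑_{i=0}^{j-1} sc(b_j - b_i)`, with inverse `ginv`, and
`bounce(a) = ∑_j (g⁻¹ a)_j`, then the pushforwards of `λ_n` under `dinv × area` and under
`area × bounce` coincide. -/
theorem qtMeasure_two_defs_agree (n : ℕ) (hn : 2 ≤ n)
    (g ginv : (Fin (n - 1) → ℝ) → (Fin (n - 1) → ℝ))
    (hgf : ∀ b ∈ bouncePoly n, g b = fmap n b)
    (hbij : Set.BijOn g (bouncePoly n) (areaPoly n))
    (hinv : Set.InvOn ginv g (bouncePoly n) (areaPoly n)) :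
    Measure.map (fun a => (dinv n a, area n a)) (volume.restrict (areaPoly n)) =
      Measure.map (fun a => (area n a, ∑ j : Fin (n - 1), ginv a j))
        (volume.restrict (areaPoly n)) := by
  obtain ⟨m, rfl⟩ : ∃ m, n = m + 1 := ⟨n - 1, by omega⟩
  have hbf : Set.BijOn (fmap (m + 1)) (bouncePoly (m + 1)) (areaPoly (m + 1)) :=
    hbij.congr hgf
  have hcov := cov m hbf
  have hgm : AEMeasurable ginv
      ((volume : Measure (Fin m → ℝ)).restrict (areaPoly (m + 1))) := by
    apply aemeasurable_restrict_of_measurable_subtype (meas_area m)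
    intro C hC
    have hC' : MeasurableSet (fmap (m + 1) '' (bouncePoly (m + 1) ∩ C)) :=
      ((meas_bounce m).inter hC).image_of_continuousOn_injOn
        (continuous_fmap m).continuousOn (hbf.injOn.mono Set.inter_subset_left)
    have : (fun x : areaPoly (m + 1) => ginv x) ⁻¹' C =
        Subtype.val ⁻¹' (fmap (m + 1) '' (bouncePoly (m + 1) ∩ C)) := by
      ext ⟨a, ha⟩
      simp only [Set.mem_preimage]
      constructor
      · intro h
        obtain ⟨b, hb, rfl⟩ := hbij.surjOn ha
        rw [hinv.1 hb] at h
        exact ⟨b, ⟨hb, h⟩, (hgf b hb).symm⟩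
      · rintro ⟨b, ⟨hb, hbC⟩, rfl⟩
        rw [← hgf b hb, hinv.1 hb]
        exact hbC
    rw [this]
    exact measurable_subtype_coe hC'
  have hh : AEMeasurable (fun a : Fin m → ℝ => (area (m + 1) a, ∑ j : Fin m, ginv a j))
      ((volume : Measure (Fin m → ℝ)).restrict (areaPoly (m + 1))) := by
    refine AEMeasurable.prodMk (measurable_snd.comp (meas_pair m)).aemeasurable ?_
    exact (Finset.measurable_sum (Finset.univ : Finset (Fin m))
      fun j _ => measurable_pi_apply j).comp_aemeasurable hgm
  refine (left_side m).trans ?_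
  have e : Measure.map (fun a : Fin m → ℝ => (area (m + 1) a, ∑ j : Fin m, ginv a j))
      ((volume : Measure (Fin m → ℝ)).restrict (areaPoly (m + 1))) =
      Measure.map (fun a : Fin m → ℝ => (dinv (m + 1) a, area (m + 1) a))
      (((volume : Measure (Fin m → ℝ)).restrict (bouncePoly (m + 1))).withDensity (wt m)) := by
    rw [← hcov] at hh ⊢
    rw [AEMeasurable.map_map_of_aemeasurable hh (continuous_fmap m).measurable.aemeasurable]
    apply Measure.map_congr
    have hac := withDensity_absolutelyContinuous
      ((volume : Measure (Fin m → ℝ)).restrict (bouncePoly (m + 1))) (wt m)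
    apply hac.ae_le
    filter_upwards [ae_restrict_mem (meas_bounce m)] with b hb
    change (area (m + 1) (fmap (m + 1) b), ∑ j : Fin m, ginv (fmap (m + 1) b) j) =
      (dinv (m + 1) b, area (m + 1) b)
    rw [area_fmap, area_sum, ← hgf b hb, hinv.1 hb]
  exact e.symm
end
end

section
/- Let b = (b_1, …, b_{n−1}) ∈ B_n satisfy 0 < b_1 < ⋯ < b_{n−1} and b_j − b_i ≠ 1 for all 0 ≤ i < j ≤ n−1 (with the convention b_0 = 0). Then the map f : ℝ^{n−1} → ℝ^{n−1} is differentiable at b, and the absolute value of the determinant of its derivative at b equals ∏_{j=1}^{n−1} #{i : 0 ≤ i < j and b_j − b_i < 1}. -/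
open MeasureTheory Finset Filter

noncomputable section

theorem sc_hasDerivAt (x : ℝ) (h0 : 0 < x) (h1 : x ≠ 1) :
    HasDerivAt sc (-(if x < 1 then 1 else 0)) x := by
  rcases lt_or_gt_of_ne h1 with h | h
  · rw [if_pos h]
    have hd : HasDerivAt (fun y : ℝ => 1 - y) (-1) x := by
      simpa using (hasDerivAt_id x).const_sub 1
    refine hd.congr_of_eventuallyEq ?_
    filter_upwards [Ioo_mem_nhds h0 h] with y hy
    simp only [sc]
    rw [abs_of_pos hy.1, max_eq_left (by linarith [hy.2])]
  · rw [if_neg (by linarith), neg_zero]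
    refine (hasDerivAt_const x (0 : ℝ)).congr_of_eventuallyEq ?_
    filter_upwards [Ioi_mem_nhds h] with y hy
    have hy' : 1 < y := hy
    simp only [sc]
    rw [abs_of_pos (by linarith), max_eq_right (by linarith)]

def cextL (k : ℕ) (i : ℕ) : (Fin k → ℝ) →L[ℝ] ℝ :=
  if h : 1 ≤ i ∧ i ≤ k then ContinuousLinearMap.proj ⟨i - 1, by omega⟩ else 0

theorem cextL_apply (k i : ℕ) (a : Fin k → ℝ) : cextL k i a = cext a i := by
  unfold cextL cext
  split_ifs <;> simp

theorem cext_mono {n : ℕ} (b : Fin (n - 1) → ℝ)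
    (hsm : ∀ i < n - 1, cext b i < cext b (i + 1)) (i j : ℕ) (hij : i < j) :
    j ≤ n - 1 → cext b i < cext b j := by
  induction j, hij using Nat.le_induction with
  | base => intro h; exact hsm i (by omega)
  | succ j hj ih => intro h; exact (ih (by omega)).trans (hsm j (by omega))

def fD (n : ℕ) (b : Fin (n - 1) → ℝ) : (Fin (n - 1) → ℝ) →L[ℝ] (Fin (n - 1) → ℝ) :=
  ContinuousLinearMap.pi fun j => ∑ i ∈ Finset.range (j.1 + 1),
    (-(if cext b (j.1 + 1) - cext b i < 1 then 1 else 0 : ℝ)) •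
      (cextL (n - 1) (j.1 + 1) - cextL (n - 1) i)

theorem cext_single_zero {k : ℕ} (l : Fin k) (i : ℕ) (h : i ≤ l.1) :
    cext (Pi.single l (1 : ℝ) : Fin k → ℝ) i = 0 := by
  unfold cext
  split_ifs with h'
  · rw [Pi.single_eq_of_ne]
    intro he
    have := congrArg Fin.val he
    simp only at this
    omega
  · rfl

theorem cext_single_one {k : ℕ} (l : Fin k) :
    cext (Pi.single l (1 : ℝ) : Fin k → ℝ) (l.1 + 1) = 1 := by
  unfold cext
  rw [dif_pos ⟨by omega, by omega⟩]
  simp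

theorem fD_hasFDerivAt (n : ℕ) (b : Fin (n - 1) → ℝ)
    (hsm : ∀ i < n - 1, cext b i < cext b (i + 1))
    (hne : ∀ i j : ℕ, i < j → j ≤ n - 1 → cext b j ≠ cext b i + 1) :
    HasFDerivAt (fmap n) (fD n b) b := by
  refine hasFDerivAt_pi.2 fun j => ?_
  refine HasFDerivAt.fun_sum fun i hi => ?_
  have hij : i < j.1 + 1 := Finset.mem_range.1 hi
  have hs := sc_hasDerivAt (cext b (j.1 + 1) - cext b i)
    (sub_pos.2 (cext_mono b hsm i (j.1 + 1) hij (by omega)))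
    (fun h => hne i (j.1 + 1) hij (by omega) (by linarith))
  have hl : HasFDerivAt (fun a : Fin (n - 1) → ℝ => cext a (j.1 + 1) - cext a i)
      (cextL (n - 1) (j.1 + 1) - cextL (n - 1) i) b := by
    have := (cextL (n - 1) (j.1 + 1) - cextL (n - 1) i).hasFDerivAt (x := b)
    refine this.congr_of_eventuallyEq (Eventually.of_forall fun a => ?_)
    simp [cextL_apply]
  exact hs.comp_hasFDerivAt b hl

/-- If `b ∈ B_n` has `0 = b_0 < b_1 < ⋯ < b_{n-1}` and `b_j ≠ b_i + 1` for all `i < j`,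
then `f` is differentiable at `b` and the absolute value of its Jacobian determinant at `b`
is `∏_{j=1}^{n-1} #{i < j : b_j - b_i < 1}`. -/
theorem fmap_jacobian (n : ℕ) (hn : 2 ≤ n) (b : Fin (n - 1) → ℝ)
    (hB : b ∈ bouncePoly n)
    (hsm : ∀ i < n - 1, cext b i < cext b (i + 1))
    (hne : ∀ i j : ℕ, i < j → j ≤ n - 1 → cext b j ≠ cext b i + 1) :
    DifferentiableAt ℝ (fmap n) b ∧
    |(fderiv ℝ (fmap n) b).det| =
      ∏ j : Fin (n - 1),
        (((Finset.range (j.1 + 1)).filter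
            (fun i => cext b (j.1 + 1) - cext b i < 1)).card : ℝ) := by
  have h := fD_hasFDerivAt n b hsm hne
  refine ⟨h.differentiableAt, ?_⟩
  rw [h.fderiv, ContinuousLinearMap.det, ← LinearMap.det_toMatrix']
  have happ : ∀ j l : Fin (n - 1),
      LinearMap.toMatrix' (fD n b : (Fin (n - 1) → ℝ) →ₗ[ℝ] (Fin (n - 1) → ℝ)) j l =
      ∑ i ∈ Finset.range (j.1 + 1), (-(if cext b (j.1 + 1) - cext b i < 1 then 1 else 0 : ℝ)) *
        (cext (Pi.single l (1 : ℝ) : Fin (n - 1) → ℝ) (j.1 + 1)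
          - cext (Pi.single l (1 : ℝ) : Fin (n - 1) → ℝ) i) := by
    intro j l
    rw [LinearMap.toMatrix'_apply]
    simp only [fD, ContinuousLinearMap.coe_coe, ContinuousLinearMap.coe_pi',
      ContinuousLinearMap.sum_apply, ContinuousLinearMap.smul_apply,
      ContinuousLinearMap.sub_apply, cextL_apply, smul_eq_mul]
  rw [Matrix.det_of_lowerTriangular _ ?_, Finset.abs_prod]
  · refine Finset.prod_congr rfl fun j _ => ?_
    rw [happ, Finset.sum_congr rfl (g := fun i =>
      -(if cext b (j.1 + 1) - cext b i < 1 then 1 else 0 : ℝ))]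
    · rw [Finset.sum_neg_distrib, abs_neg, Finset.sum_boole, Nat.abs_cast]
    · intro i hi
      rw [cext_single_one, cext_single_zero j i (by have := Finset.mem_range.1 hi; omega)]
      ring
  · intro j l hjl
    have hlt : j.1 < l.1 := hjl
    rw [happ]
    refine Finset.sum_eq_zero fun i hi => ?_
    have := Finset.mem_range.1 hi
    rw [cext_single_zero l _ (by omega), cext_single_zero l _ (by omega)]
    ring
end
end
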